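/- For p > 0, the Bergman metric of the complex ellipsoid E(1,1,p) = {(z,w) : |z|² + |w|^{2p} < 1} is Kähler-Einstein (i.e., proportional to the complete Kähler-Einstein metric of Ricci curvature -1) only if p = 1; equivalently, if p ≠ 1 then at the point (0,0) ∈ E the Ricci tensor of the Bergman metric is not a scalar multiple of the metric tensor. -/

import Mathlib

noncomputable section

/-- The Bergman kernel of `E(1,1,p)` (D'Angelo's formula), polarized as a holomorphic
function of independent complex variables `z, z̄, w, w̄`:
`K = c₁ φ^{-2+1/p} ψ^{-2} + c₂ φ^{-2+2/p} ψ^{-3}` with `φ = 1 - z z̄`,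
`ψ = φ^{1/p} - w w̄`, `c₁ = (p-1)/(pπ²)`, `c₂ = 2/(pπ²)`. -/
def Kc (p : ℝ) (z zb w wb : ℂ) : ℂ :=
  (((p - 1) / (p * Real.pi ^ 2) : ℝ) : ℂ) * (1 - z * zb) ^ ((-2 + 1 / p : ℝ) : ℂ)
      * ((1 - z * zb) ^ ((1 / p : ℝ) : ℂ) - w * wb) ^ (-2 : ℂ)
    + ((2 / (p * Real.pi ^ 2) : ℝ) : ℂ) * (1 - z * zb) ^ ((-2 + 2 / p : ℝ) : ℂ)
      * ((1 - z * zb) ^ ((1 / p : ℝ) : ℂ) - w * wb) ^ (-3 : ℂ)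

/-- Wirtinger derivative `∂/∂z` (first slot). -/
def D1 (F : ℂ → ℂ → ℂ → ℂ → ℂ) : ℂ → ℂ → ℂ → ℂ → ℂ :=
  fun z zb w wb => deriv (fun t => F t zb w wb) z

/-- Wirtinger derivative `∂/∂z̄` (second slot). -/
def D1b (F : ℂ → ℂ → ℂ → ℂ → ℂ) : ℂ → ℂ → ℂ → ℂ → ℂ :=
  fun z zb w wb => deriv (fun t => F z t w wb) zb

/-- Wirtinger derivative `∂/∂w` (third slot). -/
def D2 (F : ℂ → ℂ → ℂ → ℂ → ℂ) : ℂ → ℂ → ℂ → ℂ → ℂ :=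
  fun z zb w wb => deriv (fun t => F z zb t wb) w

/-- Wirtinger derivative `∂/∂w̄` (fourth slot). -/
def D2b (F : ℂ → ℂ → ℂ → ℂ → ℂ) : ℂ → ℂ → ℂ → ℂ → ℂ :=
  fun z zb w wb => deriv (fun t => F z zb w t) wb

/-- `log K`. -/
def logK (p : ℝ) : ℂ → ℂ → ℂ → ℂ → ℂ :=
  fun z zb w wb => Complex.log (Kc p z zb w wb)

/-- Bergman metric component `g_{1 1̄} = ∂² log K / ∂z ∂z̄`. -/
def g11 (p : ℝ) : ℂ → ℂ → ℂ → ℂ → ℂ := D1 (D1b (logK p))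

/-- Bergman metric component `g_{1 2̄} = ∂² log K / ∂z ∂w̄`. -/
def g12 (p : ℝ) : ℂ → ℂ → ℂ → ℂ → ℂ := D1 (D2b (logK p))

/-- Bergman metric component `g_{2 1̄} = ∂² log K / ∂w ∂z̄`. -/
def g21 (p : ℝ) : ℂ → ℂ → ℂ → ℂ → ℂ := D2 (D1b (logK p))

/-- Bergman metric component `g_{2 2̄} = ∂² log K / ∂w ∂w̄`. -/
def g22 (p : ℝ) : ℂ → ℂ → ℂ → ℂ → ℂ := D2 (D2b (logK p))

/-- `det g = g_{1 1̄} g_{2 2̄} - g_{1 2̄} g_{2 1̄}`. -/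
def detg (p : ℝ) : ℂ → ℂ → ℂ → ℂ → ℂ :=
  fun z zb w wb => g11 p z zb w wb * g22 p z zb w wb - g12 p z zb w wb * g21 p z zb w wb

/-- `Ric_{1 1̄} = -∂² log det g / ∂z ∂z̄`. -/
def Ric11 (p : ℝ) : ℂ → ℂ → ℂ → ℂ → ℂ :=
  fun z zb w wb =>
    -(D1 (D1b fun a b c d => Complex.log (detg p a b c d)) z zb w wb)

/-- `Ric_{1 2̄}`. -/
def Ric12 (p : ℝ) : ℂ → ℂ → ℂ → ℂ → ℂ :=
  fun z zb w wb =>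
    -(D1 (D2b fun a b c d => Complex.log (detg p a b c d)) z zb w wb)

/-- `Ric_{2 1̄}`. -/
def Ric21 (p : ℝ) : ℂ → ℂ → ℂ → ℂ → ℂ :=
  fun z zb w wb =>
    -(D2 (D1b fun a b c d => Complex.log (detg p a b c d)) z zb w wb)

/-- `Ric_{2 2̄}`. -/
def Ric22 (p : ℝ) : ℂ → ℂ → ℂ → ℂ → ℂ :=
  fun z zb w wb =>
    -(D2 (D2b fun a b c d => Complex.log (detg p a b c d)) z zb w wb)

open Filter Topology

/-- The kernel as a function of the two products. -/
def kk (p : ℝ) (x y : ℂ) : ℂ :=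
  (((p - 1) / (p * Real.pi ^ 2) : ℝ) : ℂ) * (1 - x) ^ ((-2 + 1 / p : ℝ) : ℂ)
      * ((1 - x) ^ ((1 / p : ℝ) : ℂ) - y) ^ (-2 : ℂ)
    + ((2 / (p * Real.pi ^ 2) : ℝ) : ℂ) * (1 - x) ^ ((-2 + 2 / p : ℝ) : ℂ)
      * ((1 - x) ^ ((1 / p : ℝ) : ℂ) - y) ^ (-3 : ℂ)

lemma logK_eq (p : ℝ) (z zb w wb : ℂ) :
    logK p z zb w wb = Complex.log (kk p (z * zb) (w * wb)) := rfl

/-- Iterated derivative of a function of the product. -/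
lemma deriv_prod (f : ℂ → ℂ) (a b : ℂ) (h : DifferentiableAt ℂ (deriv f) (a * b)) :
    deriv (fun t => deriv (fun s => f (t * s)) b) a
      = deriv f (a * b) + a * b * deriv (deriv f) (a * b) := by
  have h1 : (fun t => deriv (fun s => f (t * s)) b) = fun t => t * deriv f (t * b) := by
    funext t
    have := deriv_comp_mul_left t f b
    simpa using this
  rw [h1]
  have h2 : HasDerivAt (fun t : ℂ => t * b) b a := by
    simpa using (hasDerivAt_id a).mul_const b
  have h3 : HasDerivAt (fun t => deriv f (t * b)) (deriv (deriv f) (a * b) * b) a :=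
    HasDerivAt.comp (h₂ := deriv f) a h.hasDerivAt h2
  have h4 := (hasDerivAt_id a).mul h3
  have h5 := h4.deriv
  simp only [id] at h5
  refine Eq.trans h5 ?_
  ring

lemma deriv_prod_zero (f : ℂ → ℂ) (F : ℂ → ℂ → ℂ)
    (h : ∀ᶠ x in 𝓝 (0 : ℂ), ∀ t s, t * s = x → F t s = f x) :
    deriv (fun t => deriv (fun s => F t s) 0) 0 = deriv f 0 := by
  have h1 : (fun t => deriv (fun s => F t s) 0) = fun t => t * deriv f 0 := by
    funext t
    have h0 : (fun s => F t s) =ᶠ[𝓝 0] fun s => f (t * s) := by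
      have hc : Tendsto (fun s : ℂ => t * s) (𝓝 0) (𝓝 0) := by
        have : Continuous fun s : ℂ => t * s := by fun_prop
        simpa using this.tendsto 0
      filter_upwards [hc.eventually h] with s hs
      exact hs t s rfl
    rw [h0.deriv_eq]
    have := deriv_comp_mul_left t f 0
    simpa using this
  rw [h1]
  simp

lemma g12_zero_left (p : ℝ) (w wb : ℂ) : g12 p 0 0 w wb = 0 := by
  simp [g12, D1, D2b, logK_eq]

lemma g12_zero_right (p : ℝ) (z zb : ℂ) : g12 p z zb 0 0 = 0 := by
  simp [g12, D1, D2b, logK_eq]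

/-- Simplified form of the kernel. -/
lemma kk_eq (p : ℝ) (x y : ℂ) (hx : 1 - x ≠ 0) :
    kk p x y = (1 / ((p : ℂ) * (Real.pi : ℂ) ^ 2)) * (((1 - x) ^ 2)⁻¹ *
      (((p : ℂ) - 1) * (1 - x) ^ (1 / (p : ℂ)) / ((1 - x) ^ (1 / (p : ℂ)) - y) ^ 2
        + 2 * ((1 - x) ^ (1 / (p : ℂ))) ^ 2 / ((1 - x) ^ (1 / (p : ℂ)) - y) ^ 3)) := by
  unfold kk
  have e1 : ((1 / p : ℝ) : ℂ) = 1 / (p : ℂ) := by push_cast; ring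
  have e2 : ((-2 + 1 / p : ℝ) : ℂ) = -2 + 1 / (p : ℂ) := by push_cast; ring
  have e3 : ((-2 + 2 / p : ℝ) : ℂ) = -2 + 1 / (p : ℂ) + 1 / (p : ℂ) := by push_cast; ring
  have n2 : ∀ u : ℂ, u ^ (-2 : ℂ) = (u ^ 2)⁻¹ := by
    intro u; rw [Complex.cpow_neg, Complex.cpow_ofNat]
  have n3 : ∀ u : ℂ, u ^ (-3 : ℂ) = (u ^ 3)⁻¹ := by
    intro u; rw [Complex.cpow_neg, Complex.cpow_ofNat]
  rw [e1, e2, e3, Complex.cpow_add (-2 + 1 / (p : ℂ)) _ hx,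
    Complex.cpow_add (-2) _ hx, n2, n2, n3]
  push_cast
  simp only [div_eq_mul_inv]
  ring_nf

lemma c0_ne (p : ℝ) (hp : 0 < p) : (1 / ((p : ℂ) * (Real.pi : ℂ) ^ 2)) ≠ 0 := by
  have h1 : (p : ℂ) ≠ 0 := by exact_mod_cast hp.ne'
  have h2 : (Real.pi : ℂ) ≠ 0 := by exact_mod_cast Real.pi_ne_zero
  exact one_div_ne_zero (mul_ne_zero h1 (pow_ne_zero 2 h2))

lemma kk_zero_slit (p : ℝ) (hp : 0 < p) : kk p 0 0 ∈ Complex.slitPlane := by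
  rw [kk_eq p 0 0 (by simp)]
  have : (1 / ((p : ℂ) * (Real.pi : ℂ) ^ 2)) * (((1 - 0) ^ 2)⁻¹ *
      (((p : ℂ) - 1) * (1 - 0) ^ (1 / (p : ℂ)) / ((1 - 0) ^ (1 / (p : ℂ)) - 0) ^ 2
        + 2 * ((1 - 0) ^ (1 / (p : ℂ))) ^ 2 / ((1 - 0) ^ (1 / (p : ℂ)) - 0) ^ 3))
      = (((p + 1) / (p * Real.pi ^ 2) : ℝ) : ℂ) := by
    simp
    ring
  rw [this]
  exact Complex.ofReal_mem_slitPlane.2 (by have := Real.pi_pos; positivity)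

lemma hasDerivAt_v (p : ℝ) (x : ℂ) (hx : 1 - x ∈ Complex.slitPlane) :
    HasDerivAt (fun x : ℂ => (1 - x) ^ (1 / (p : ℂ)))
      (-(1 / (p : ℂ)) * (1 - x) ^ (1 / (p : ℂ)) / (1 - x)) x := by
  have h0 : (1 - x) ≠ 0 := Complex.slitPlane_ne_zero hx
  have h1 : HasDerivAt (fun x : ℂ => 1 - x) (-1) x := by
    simpa using (hasDerivAt_id x).const_sub 1
  have h2 := h1.cpow_const (c := 1 / (p : ℂ)) hx
  convert h2 using 1
  rw [Complex.cpow_sub _ _ h0, Complex.cpow_one]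
  ring

lemma ev_slit : ∀ᶠ x in 𝓝 (0 : ℂ), 1 - x ∈ Complex.slitPlane := by
  have hc : ContinuousAt (fun x : ℂ => 1 - x) 0 := by fun_prop
  exact hc.eventually (Complex.isOpen_slitPlane.mem_nhds (by simp))

lemma kk_hasDerivAt_fst (p : ℝ) (x y : ℂ) (hx : 1 - x ∈ Complex.slitPlane)
    (hv : (1 - x) ^ (1 / (p : ℂ)) - y ≠ 0) :
    HasDerivAt (fun x => kk p x y)
      ((1 / ((p : ℂ) * (Real.pi : ℂ) ^ 2)) *
        (2 / (1 - x) ^ 3 *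
      (((p : ℂ) - 1) * (1 - x) ^ (1 / (p : ℂ)) / ((1 - x) ^ (1 / (p : ℂ)) - y) ^ 2
        + 2 * ((1 - x) ^ (1 / (p : ℂ))) ^ 2 / ((1 - x) ^ (1 / (p : ℂ)) - y) ^ 3) +
        ((1 - x) ^ 2)⁻¹ * ((-(1 / (p : ℂ)) * (1 - x) ^ (1 / (p : ℂ)) / (1 - x)) *
          (((p : ℂ) - 1) / ((1 - x) ^ (1 / (p : ℂ)) - y) ^ 2
           - 2 * ((p : ℂ) - 1) * (1 - x) ^ (1 / (p : ℂ)) / ((1 - x) ^ (1 / (p : ℂ)) - y) ^ 3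
           + 4 * (1 - x) ^ (1 / (p : ℂ)) / ((1 - x) ^ (1 / (p : ℂ)) - y) ^ 3
           - 6 * ((1 - x) ^ (1 / (p : ℂ))) ^ 2 / ((1 - x) ^ (1 / (p : ℂ)) - y) ^ 4)))) x := by
  have h0 : (1 - x) ≠ 0 := Complex.slitPlane_ne_zero hx
  have hev : (fun x => kk p x y) =ᶠ[𝓝 x] _ :=
    ((continuous_const.sub continuous_id).continuousAt.eventually_ne h0).mono
      (fun x' hx' => kk_eq p x' y hx')
  refine HasDerivAt.congr_of_eventuallyEq ?_ hev
  have hV := hasDerivAt_v p x hx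
  have h1 : HasDerivAt (fun x : ℂ => 1 - x) (-1) x := by
    simpa using (hasDerivAt_id x).const_sub 1
  have hA := (h1.pow 2).inv (pow_ne_zero 2 h0)
  have hB := (hV.const_mul ((p : ℂ) - 1)).div ((hV.sub_const y).pow 2) (pow_ne_zero 2 hv)
  have hC := ((hV.pow 2).const_mul (2 : ℂ)).div ((hV.sub_const y).pow 3) (pow_ne_zero 3 hv)
  have hD := (hA.mul (hB.add hC)).const_mul (1 / ((p : ℂ) * (Real.pi : ℂ) ^ 2))
  refine hD.congr_deriv ?_
  simp only [Pi.add_apply, Pi.pow_apply, Pi.div_apply, Pi.inv_apply]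
  congr 1
  set v := (1 - x) ^ (1 / (p : ℂ)) with hvdef
  generalize 1 / (p : ℂ) = r
  clear_value v
  generalize 1 - x = φ at *
  push_cast
  field_simp
  ring

lemma kk_hasDerivAt_snd (p : ℝ) (x y : ℂ) (hx : 1 - x ≠ 0)
    (hv : (1 - x) ^ (1 / (p : ℂ)) - y ≠ 0) :
    HasDerivAt (fun y => kk p x y)
      ((1 / ((p : ℂ) * (Real.pi : ℂ) ^ 2)) * (((1 - x) ^ 2)⁻¹ *
      (2 * ((p : ℂ) - 1) * (1 - x) ^ (1 / (p : ℂ)) / ((1 - x) ^ (1 / (p : ℂ)) - y) ^ 3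
        + 6 * ((1 - x) ^ (1 / (p : ℂ))) ^ 2 / ((1 - x) ^ (1 / (p : ℂ)) - y) ^ 4))) y := by
  have hev : (fun y => kk p x y) = _ := funext fun y' => kk_eq p x y' hx
  rw [hev]
  generalize (1 - x) ^ (1 / (p : ℂ)) = v at *
  have h1 : HasDerivAt (fun y : ℂ => v - y) (-1) y := by
    simpa using (hasDerivAt_id y).const_sub v
  have hB := (hasDerivAt_const y (((p : ℂ) - 1) * v)).div (h1.pow 2) (pow_ne_zero 2 hv)
  have hC := (hasDerivAt_const y (2 * v ^ 2)).div (h1.pow 3) (pow_ne_zero 3 hv)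
  have hD := ((hB.add hC).const_mul (((1 - x) ^ 2)⁻¹)).const_mul
    (1 / ((p : ℂ) * (Real.pi : ℂ) ^ 2))
  refine hD.congr_deriv ?_
  simp only [Pi.add_apply, Pi.pow_apply, Pi.div_apply, Pi.inv_apply]
  congr 2
  push_cast
  field_simp
  ring

lemma ev_kk_fst (p : ℝ) (hp : 0 < p) :
    ∀ᶠ x in 𝓝 (0 : ℂ), kk p x 0 ∈ Complex.slitPlane := by
  have hc := (kk_hasDerivAt_fst p 0 0 (by simp) (by simp)).continuousAt
  exact hc.eventually (Complex.isOpen_slitPlane.mem_nhds (kk_zero_slit p hp))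

lemma ev_kk_snd (p : ℝ) (hp : 0 < p) :
    ∀ᶠ y in 𝓝 (0 : ℂ), kk p 0 y ∈ Complex.slitPlane := by
  have hc := (kk_hasDerivAt_snd p 0 0 (by simp) (by simp)).continuousAt
  exact hc.eventually (Complex.isOpen_slitPlane.mem_nhds (kk_zero_slit p hp))

lemma p_ne (p : ℝ) (hp : 0 < p) : (p : ℂ) ≠ 0 ∧ (p : ℂ) + 1 ≠ 0 ∧ (p : ℂ) + 2 ≠ 0
    ∧ 2 * (p : ℂ) + 1 ≠ 0 := by
  refine ⟨?_, ?_, ?_, ?_⟩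
  · exact_mod_cast hp.ne'
  · exact_mod_cast (by positivity : p + 1 ≠ 0)
  · exact_mod_cast (by positivity : p + 2 ≠ 0)
  · exact_mod_cast (by positivity : 2 * p + 1 ≠ 0)

/-- Slice `w = 0`, first derivative of `log K` in `x`. -/
lemma sliceA_f (p : ℝ) (hp : 0 < p) : ∀ᶠ x in 𝓝 (0 : ℂ),
    deriv (fun x => Complex.log (kk p x 0)) x = (2 + 1 / (p : ℂ)) / (1 - x) := by
  filter_upwards [ev_slit, ev_kk_fst p hp] with x hx hk
  have h0 : (1 - x) ≠ 0 := Complex.slitPlane_ne_zero hx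
  have hv : (1 - x) ^ (1 / (p : ℂ)) ≠ 0 := by
    simp [Complex.cpow_eq_zero_iff, h0]
  have hd := (kk_hasDerivAt_fst p x 0 hx (by simpa using hv)).clog hk
  rw [hd.deriv, kk_eq p x 0 h0]
  obtain ⟨hp0, hp1, -, -⟩ := p_ne p hp
  rw [mul_div_mul_left _ _ (c0_ne p hp)]
  generalize (1 - x) ^ (1 / (p : ℂ)) = v at *
  generalize 1 - x = φ at *
  generalize (p : ℂ) = P at *
  simp only [sub_zero]
  have e : (φ ^ 2)⁻¹ * ((P - 1) * v / v ^ 2 + 2 * v ^ 2 / v ^ 3) = (P + 1) / (φ ^ 2 * v) := by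
    field_simp; ring
  rw [e]
  field_simp
  ring

lemma sliceA_g11 (p : ℝ) (hp : 0 < p) : ∀ᶠ x in 𝓝 (0 : ℂ), ∀ z zb, z * zb = x →
    g11 p z zb 0 0 = (2 + 1 / (p : ℂ)) / (1 - x) ^ 2 := by
  filter_upwards [(sliceA_f p hp).eventually_nhds, ev_slit] with x hf hx z zb hz
  have h0 : (1 - x) ≠ 0 := Complex.slitPlane_ne_zero hx
  have h1 : HasDerivAt (fun x : ℂ => 1 - x) (-1) x := by
    simpa using (hasDerivAt_id x).const_sub 1
  have h2 : HasDerivAt (deriv (fun x => Complex.log (kk p x 0)))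
      ((2 + 1 / (p : ℂ)) / (1 - x) ^ 2) x := by
    refine HasDerivAt.congr_of_eventuallyEq ?_ hf
    refine ((hasDerivAt_const x (2 + 1 / (p : ℂ))).div h1 h0).congr_deriv ?_
    simp
  have h3 : g11 p z zb 0 0 = deriv (fun t => deriv (fun s => Complex.log (kk p (t * s) 0)) zb) z := by
    simp [g11, D1, D1b, logK_eq]
  rw [h3, deriv_prod (fun x => Complex.log (kk p x 0)) z zb (by rw [hz]; exact h2.differentiableAt),
    hz, h2.deriv, hf.self_of_nhds]
  field_simp
  ring

lemma sliceA_g22 (p : ℝ) (hp : 0 < p) : ∀ᶠ x in 𝓝 (0 : ℂ), ∀ z zb, z * zb = x →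
    g22 p z zb 0 0 = (2 * ((p : ℂ) + 2) / ((p : ℂ) + 1)) / (1 - x) ^ (1 / (p : ℂ)) := by
  filter_upwards [ev_slit, ev_kk_fst p hp] with x hx hk z zb hz
  have h0 : (1 - x) ≠ 0 := Complex.slitPlane_ne_zero hx
  have hv : (1 - x) ^ (1 / (p : ℂ)) ≠ 0 := by
    simp [Complex.cpow_eq_zero_iff, h0]
  have h3 : g22 p z zb 0 0 = deriv (fun t => deriv (fun s => Complex.log (kk p x (t * s))) 0) 0 := by
    simp [g22, D2, D2b, logK_eq, hz]
  rw [h3, deriv_prod_zero (fun y => Complex.log (kk p x y)) _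
    (Eventually.of_forall fun y t s h => by rw [h])]
  have hd := (kk_hasDerivAt_snd p x 0 h0 (by simpa using hv)).clog hk
  rw [hd.deriv, kk_eq p x 0 h0]
  obtain ⟨hp0, hp1, -, -⟩ := p_ne p hp
  rw [mul_div_mul_left _ _ (c0_ne p hp), mul_div_mul_left _ _ (inv_ne_zero (pow_ne_zero 2 h0))]
  generalize (1 - x) ^ (1 / (p : ℂ)) = v at *
  generalize (p : ℂ) = P at *
  simp only [sub_zero]
  have e : ((P - 1) * v / v ^ 2 + 2 * v ^ 2 / v ^ 3) = (P + 1) / v := by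
    field_simp; ring
  rw [e]
  field_simp
  ring

lemma Ric11_eq (p : ℝ) (hp : 0 < p) : Ric11 p 0 0 0 0 = -(2 + 1 / (p : ℂ)) := by
  obtain ⟨hp0, hp1, hp2, hp3⟩ := p_ne p hp
  have h : Ric11 p 0 0 0 0 = -deriv (fun x => Complex.log ((2 + 1 / (p : ℂ)) / (1 - x) ^ 2 *
      ((2 * ((p : ℂ) + 2) / ((p : ℂ) + 1)) / (1 - x) ^ (1 / (p : ℂ))))) 0 := by
    unfold Ric11 D1 D1b
    congr 1
    apply deriv_prod_zero (F := fun t s => Complex.log (detg p t s 0 0))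
    filter_upwards [sliceA_g11 p hp, sliceA_g22 p hp] with x ha hb z zb hz
    rw [detg, ha z zb hz, hb z zb hz, g12_zero_right, zero_mul, sub_zero]
  rw [h]
  congr 1
  have h1 : HasDerivAt (fun x : ℂ => 1 - x) (-1) 0 := by
    simpa using (hasDerivAt_id (0 : ℂ)).const_sub 1
  have hV := hasDerivAt_v p 0 (by simp)
  have hA := (hasDerivAt_const (0 : ℂ) (2 + 1 / (p : ℂ))).div (h1.pow 2) (by simp)
  have hB := (hasDerivAt_const (0 : ℂ) (2 * ((p : ℂ) + 2) / ((p : ℂ) + 1))).div hV (by simp)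
  have hD := (hA.mul hB).clog (by
    have : (((2 + 1 / p) * (2 * (p + 2) / (p + 1)) : ℝ) : ℂ) ∈ Complex.slitPlane :=
      Complex.ofReal_mem_slitPlane.2 (by positivity)
    push_cast at this
    simpa using this)
  refine Eq.trans hD.deriv ?_
  have hq : 2 + 1 / (p : ℂ) ≠ 0 := by
    have : 2 + 1 / (p : ℂ) = (2 * (p : ℂ) + 1) / p := by field_simp
    rw [this]; exact div_ne_zero hp3 hp0
  simp
  field_simp

lemma ev_ne (a b : ℂ) (ha : a ≠ 0) : ∀ᶠ y in 𝓝 (0 : ℂ), a - b * y ≠ 0 := by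
  have hc : ContinuousAt (fun y : ℂ => a - b * y) 0 := by fun_prop
  exact hc.eventually_ne (by simpa using ha)

/-- Slice `z = 0`, logarithmic derivative in `y`. -/
lemma sliceB_f (p : ℝ) (hp : 0 < p) : ∀ᶠ y in 𝓝 (0 : ℂ),
    deriv (fun y => Complex.log (kk p 0 y)) y
      = 3 / (1 - y) - ((p : ℂ) - 1) / ((p : ℂ) + 1 - ((p : ℂ) - 1) * y) := by
  obtain ⟨hp0, hp1, -, -⟩ := p_ne p hp
  filter_upwards [ev_slit, ev_kk_snd p hp, ev_ne _ ((p : ℂ) - 1) hp1] with y hy hk hn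
  have h0 : (1 - y) ≠ 0 := Complex.slitPlane_ne_zero hy
  have hd := (kk_hasDerivAt_snd p 0 y (by simp) (by simpa using h0)).clog hk
  rw [hd.deriv, kk_eq p 0 y (by simp)]
  rw [mul_div_mul_left _ _ (c0_ne p hp)]
  simp only [sub_zero, Complex.one_cpow, one_pow, inv_one, one_mul, mul_one]
  generalize (p : ℂ) = P at *
  have e : ((P - 1) / (1 - y) ^ 2 + 2 / (1 - y) ^ 3) = (P + 1 - (P - 1) * y) / (1 - y) ^ 3 := by
    field_simp; ring
  rw [e]
  field_simp
  ring

lemma sliceB_g22 (p : ℝ) (hp : 0 < p) : ∀ᶠ y in 𝓝 (0 : ℂ), ∀ w wb, w * wb = y →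
    g22 p 0 0 w wb = 3 / (1 - y) ^ 2
      - ((p : ℂ) - 1) * ((p : ℂ) + 1) / ((p : ℂ) + 1 - ((p : ℂ) - 1) * y) ^ 2 := by
  obtain ⟨hp0, hp1, -, -⟩ := p_ne p hp
  filter_upwards [(sliceB_f p hp).eventually_nhds, ev_slit, ev_ne _ ((p : ℂ) - 1) hp1]
    with y hf hy hn w wb hw
  have h0 : (1 - y) ≠ 0 := Complex.slitPlane_ne_zero hy
  have h1 : HasDerivAt (fun y : ℂ => 1 - y) (-1) y := by
    simpa using (hasDerivAt_id y).const_sub 1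
  have h1' : HasDerivAt (fun y : ℂ => (p : ℂ) + 1 - ((p : ℂ) - 1) * y) (-((p : ℂ) - 1)) y := by
    simpa using ((hasDerivAt_id y).const_mul ((p : ℂ) - 1)).const_sub ((p : ℂ) + 1)
  have h2 : HasDerivAt (deriv (fun y => Complex.log (kk p 0 y)))
      (3 / (1 - y) ^ 2 - ((p : ℂ) - 1) ^ 2 / ((p : ℂ) + 1 - ((p : ℂ) - 1) * y) ^ 2) y := by
    refine HasDerivAt.congr_of_eventuallyEq ?_ hf
    refine (((hasDerivAt_const y (3 : ℂ)).div h1 h0).sub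
      ((hasDerivAt_const y ((p : ℂ) - 1)).div h1' hn)).congr_deriv ?_
    ring
  have h3 : g22 p 0 0 w wb = deriv (fun t => deriv (fun s => Complex.log (kk p 0 (t * s))) wb) w := by
    simp [g22, D2, D2b, logK_eq]
  rw [h3, deriv_prod (fun y => Complex.log (kk p 0 y)) w wb (by rw [hw]; exact h2.differentiableAt),
    hw, h2.deriv, hf.self_of_nhds]
  generalize (p : ℂ) = P at *
  clear hf h1' h2
  generalize hD : P + 1 - (P - 1) * y = D at *
  have hP : P + 1 = D + (P - 1) * y := by rw [← hD]; ring
  rw [hP]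
  field_simp
  ring

lemma sliceB_g11 (p : ℝ) (hp : 0 < p) : ∀ᶠ y in 𝓝 (0 : ℂ), ∀ w wb, w * wb = y →
    g11 p 0 0 w wb = 2 + 1 / (p : ℂ) + y / p *
      (3 / (1 - y) - ((p : ℂ) - 1) / ((p : ℂ) + 1 - ((p : ℂ) - 1) * y)) := by
  obtain ⟨hp0, hp1, -, -⟩ := p_ne p hp
  filter_upwards [ev_slit, ev_kk_snd p hp, ev_ne _ ((p : ℂ) - 1) hp1] with y hy hk hn w wb hw
  have h0 : (1 - y) ≠ 0 := Complex.slitPlane_ne_zero hy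
  have h3 : g11 p 0 0 w wb = deriv (fun t => deriv (fun s => Complex.log (kk p (t * s) y)) 0) 0 := by
    simp [g11, D1, D1b, logK_eq, hw]
  rw [h3, deriv_prod_zero (fun x => Complex.log (kk p x y)) _
    (Eventually.of_forall fun y t s h => by rw [h])]
  have hd := (kk_hasDerivAt_fst p 0 y (by simp) (by simpa using h0)).clog hk
  rw [hd.deriv, kk_eq p 0 y (by simp)]
  rw [mul_div_mul_left _ _ (c0_ne p hp)]
  simp only [sub_zero, Complex.one_cpow, one_pow, inv_one, one_mul, mul_one, div_one]
  generalize (p : ℂ) = P at *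
  have e : ((P - 1) / (1 - y) ^ 2 + 2 / (1 - y) ^ 3) = (P + 1 - (P - 1) * y) / (1 - y) ^ 3 := by
    field_simp; ring
  rw [e]
  field_simp
  ring

lemma Ric22_eq (p : ℝ) (hp : 0 < p) : Ric22 p 0 0 0 0 =
    -(2 * (2 * (p : ℂ) ^ 3 + 10 * p ^ 2 + 10 * p + 5) / ((p + 1) * (p + 2) * (2 * p + 1))) := by
  obtain ⟨hp0, hp1, hp2, hp3⟩ := p_ne p hp
  have h : Ric22 p 0 0 0 0 = -deriv (fun y => Complex.log ((2 + 1 / (p : ℂ) + y / p *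
      (3 / (1 - y) - ((p : ℂ) - 1) / ((p : ℂ) + 1 - ((p : ℂ) - 1) * y))) * (3 / (1 - y) ^ 2
      - ((p : ℂ) - 1) * ((p : ℂ) + 1) / ((p : ℂ) + 1 - ((p : ℂ) - 1) * y) ^ 2))) 0 := by
    unfold Ric22 D2 D2b
    congr 1
    apply deriv_prod_zero (F := fun t s => Complex.log (detg p 0 0 t s))
    filter_upwards [sliceB_g11 p hp, sliceB_g22 p hp] with x ha hb z zb hz
    rw [detg, ha z zb hz, hb z zb hz, g12_zero_left, zero_mul, sub_zero]
  rw [h]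
  congr 1
  have h1 : HasDerivAt (fun x : ℂ => 1 - x) (-1) 0 := by
    simpa using (hasDerivAt_id (0 : ℂ)).const_sub 1
  have h1' : HasDerivAt (fun y : ℂ => (p : ℂ) + 1 - ((p : ℂ) - 1) * y) (-((p : ℂ) - 1)) 0 := by
    simpa using ((hasDerivAt_id (0 : ℂ)).const_mul ((p : ℂ) - 1)).const_sub ((p : ℂ) + 1)
  have hH := ((hasDerivAt_const (0 : ℂ) (3 : ℂ)).div h1 (by simp)).sub
      ((hasDerivAt_const (0 : ℂ) ((p : ℂ) - 1)).div h1' (by simpa using hp1))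
  have hA := (((hasDerivAt_id (0 : ℂ)).div_const (p : ℂ)).mul hH).const_add (2 + 1 / (p : ℂ))
  have hB := ((hasDerivAt_const (0 : ℂ) (3 : ℂ)).div (h1.pow 2) (by simp)).sub
      ((hasDerivAt_const (0 : ℂ) (((p : ℂ) - 1) * ((p : ℂ) + 1))).div (h1'.pow 2)
        (by simpa using hp1))
  have eB : 3 - ((p : ℂ) - 1) * ((p : ℂ) + 1) / ((p : ℂ) + 1) ^ 2
      = 2 * ((p : ℂ) + 2) / ((p : ℂ) + 1) := by
    field_simp; ring
  have hq : 2 + 1 / (p : ℂ) = (2 * (p : ℂ) + 1) / p := by field_simp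
  have hD := (hA.mul hB).clog (by
    have : (((2 + 1 / p) * (2 * (p + 2) / (p + 1)) : ℝ) : ℂ) ∈ Complex.slitPlane :=
      Complex.ofReal_mem_slitPlane.2 (by positivity)
    push_cast at this
    rw [← eB] at this
    simpa using this)
  refine Eq.trans hD.deriv ?_
  simp only [Pi.add_apply, Pi.pow_apply, Pi.div_apply, Pi.inv_apply, Pi.sub_apply, Pi.mul_apply,
    id, sub_zero, mul_zero, zero_mul, zero_div, one_pow, div_one, add_zero]
  rw [eB, hq]
  generalize (p : ℂ) = P at *
  push_cast
  field_simp
  ring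

/-- If `p ≠ 1`, the Ricci tensor of the Bergman metric of `E(1,1,p)` at the origin
is not a scalar multiple of the metric tensor; in particular the Bergman metric is
not Kähler–Einstein. -/
theorem stmt_9 (p : ℝ) (hp : 0 < p) (hp1 : p ≠ 1) :
    ¬ ∃ lam : ℂ,
        Ric11 p 0 0 0 0 = lam * g11 p 0 0 0 0 ∧
        Ric12 p 0 0 0 0 = lam * g12 p 0 0 0 0 ∧
        Ric21 p 0 0 0 0 = lam * g21 p 0 0 0 0 ∧
        Ric22 p 0 0 0 0 = lam * g22 p 0 0 0 0 := by
  rintro ⟨lam, h11, -, -, h22⟩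
  obtain ⟨hp0, hq1, hq2, hq3⟩ := p_ne p hp
  rw [Ric11_eq p hp, (sliceA_g11 p hp).self_of_nhds 0 0 (by simp)] at h11
  rw [Ric22_eq p hp, (sliceA_g22 p hp).self_of_nhds 0 0 (by simp)] at h22
  have hq : 2 + 1 / (p : ℂ) = (2 * (p : ℂ) + 1) / p := by field_simp
  have hlam : lam = -1 := by
    have h0 : 2 + 1 / (p : ℂ) ≠ 0 := by rw [hq]; exact div_ne_zero hq3 hp0
    apply mul_right_cancel₀ h0
    simp only [sub_zero, one_pow, div_one] at h11
    rw [← h11]; ring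
  rw [hlam] at h22
  simp only [sub_zero, Complex.one_cpow, div_one] at h22
  field_simp at h22
  have h : ((p : ℂ) - 1) ^ 2 = 0 := by linear_combination -h22
  have h' : (p : ℂ) = 1 := sub_eq_zero.1 (pow_eq_zero_iff (two_ne_zero) |>.1 h)
  exact hp1 (by exact_mod_cast h')
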